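/- Let N = {0, 1, …, n−1} with n ≥ 2, let x : N × N → {0, 1}, and suppose there exist real numbers u_i for i ∈ N \ {0} satisfying the Miller–Tucker–Zemlin constraints u_i − u_j + n·x_ij ≤ n − 1 for all distinct i, j ∈ N \ {0}. Then the directed graph with arc set {(i, j) : x_ij = 1} contains no directed cycle all of whose nodes lie in N \ {0}; i.e. every directed cycle in the selected route must pass through the depot node 0. -/

import Mathlib

/-- Miller–Tucker–Zemlin subtour elimination: let `N = {0, …, n-1}` with `n ≥ 2`,
`x : N × N → {0,1}`, and suppose real sequencing variables `u_i` satisfy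
`u_i - u_j + n x_ij ≤ n - 1` for all distinct non-depot `i, j`. Then the digraph
with arcs `{(i,j) : x_ij = 1}` contains no directed cycle all of whose nodes avoid
the depot node `0`. -/
theorem mtz_no_subtour
    (n : ℕ) (hn : 2 ≤ n)
    (x : Fin n → Fin n → ℝ) (hx : ∀ i j, x i j = 0 ∨ x i j = 1)
    (u : Fin n → ℝ)
    (depot : Fin n) (hdepot : (depot : ℕ) = 0)
    (hMTZ : ∀ i j : Fin n, i ≠ depot → j ≠ depot → i ≠ j →
      u i - u j + (n : ℝ) * x i j ≤ (n : ℝ) - 1) :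
    ¬ ∃ (m : ℕ) (c : ℕ → Fin n),
        2 ≤ m ∧
        (∀ i j, i < m → j < m → c i = c j → i = j) ∧
        (∀ i < m, c i ≠ depot) ∧
        (∀ i < m, x (c i) (c ((i + 1) % m)) = 1) := by
  rintro ⟨m, c, hm, hinj, hc, harc⟩
  have step : ∀ i < m, u (c i) + 1 ≤ u (c ((i + 1) % m)) := by
    intro i hi
    have hlt : (i + 1) % m < m := Nat.mod_lt _ (by omega)
    have hne : c i ≠ c ((i + 1) % m) := by
      intro h
      have hidx := hinj i _ hi hlt h
      rcases Nat.lt_or_ge (i + 1) m with h1 | h1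
      · rw [Nat.mod_eq_of_lt h1] at hidx
        omega
      · rw [show i + 1 = m by omega, Nat.mod_self] at hidx
        omega
    have := hMTZ _ _ (hc i hi) (hc _ hlt) hne
    rw [harc i hi] at this
    linarith
  have mono : ∀ k < m, u (c 0) + k ≤ u (c k) := by
    intro k
    induction k with
    | zero => simp
    | succ k ih =>
      intro hk
      have hs := step k (by omega)
      rw [Nat.mod_eq_of_lt hk] at hs
      have := ih (by omega)
      push_cast
      linarith
  have hlast := step (m - 1) (by omega)
  rw [Nat.sub_add_cancel (by omega), Nat.mod_self] at hlast
  have := mono (m - 1) (by omega)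
  have : (0 : ℝ) ≤ ((m - 1 : ℕ) : ℝ) := Nat.cast_nonneg _
  linarith
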